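/- Let S and A be nonempty finite types, p₀ a probability mass function on S, π a policy, g : S → A → ℝ, T ≥ 1 and N ≥ 1 natural numbers, and for each t ∈ {1,…,T−1} let p_t : S → A → S → ℝ be a transition kernel. Let Var_N denote the variance of the N-action estimator G_N, and for each t let Cov_{N,t} denote the covariance of G_N at lag t under the joint law s₀ ∼ p₀, a¹,…,aᴺ i.i.d. ∼ π(·|s₀), s_t ∼ p_t(·|s₀,a¹), b¹,…,bᴺ i.i.d. ∼ π(·|s_t). Define V = (1/T)·Var_N + 2·∑_{t=1}^{T−1} ((T−t)/T²)·Cov_{N,t}. Then, writing ḡ(s) = ∑_a π(a|s)·g(s,a), m_t(s₀,a) = ∑_{s'} p_t(s'|s₀,a)·ḡ(s'), and m̄_t(s₀) = ∑_a π(a|s₀)·m_t(s₀,a): T·V = [ Var_{s∼p₀}[ḡ] + 2·∑_{t=1}^{T−1} ((T−t)/T)·( ∑_{s₀} p₀(s₀)·ḡ(s₀)·m̄_t(s₀) − (∑_s p₀(s)·ḡ(s))·(∑_s p₀(s)·m̄_t(s)) ) ] + (1/N)·[ E_{s∼p₀}[Var_{a∼π(·|s)}[g(s,a)]] + 2·∑_{t=1}^{T−1}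 ((T−t)/T)·( ∑_{s₀} p₀(s₀)·( ∑_a π(a|s₀)·g(s₀,a)·m_t(s₀,a) − ḡ(s₀)·m̄_t(s₀) ) ) ]; that is, the SPG variance splits into a marginalized-policy component reduced only by T and a policy-dependent component reduced by both N and T. -/

import Mathlib

open Finset

/-- `ḡ(s) = ∑_a π(a|s)·g(s,a)`, the policy-marginalized integrand. -/
noncomputable def gbar {S A : Type*} [Fintype A]
    (π : S → A → ℝ) (g : S → A → ℝ) (s : S) : ℝ :=
  ∑ a, π s a * g s a

/-- `m_t(s₀,a) = ∑_{s'} p_t(s'|s₀,a)·ḡ(s')`. -/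
noncomputable def mker {S A : Type*} [Fintype S] [Fintype A]
    (π : S → A → ℝ) (g : S → A → ℝ) (pt : S → A → S → ℝ) (s0 : S) (a : A) : ℝ :=
  ∑ s', pt s0 a s' * gbar π g s'

/-- `m̄_t(s₀) = ∑_a π(a|s₀)·m_t(s₀,a)`. -/
noncomputable def mbar {S A : Type*} [Fintype S] [Fintype A]
    (π : S → A → ℝ) (g : S → A → ℝ) (pt : S → A → S → ℝ) (s0 : S) : ℝ :=
  ∑ a, π s0 a * mker π g pt s0 a

/-- Variance of the `N`-action estimator `G_N(s,a) = (1/N)·∑ₙ g(s,aₙ)` under the joint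
law where `s ∼ p₀` and `a₁,…,a_N` are i.i.d. from `π(·|s)`. -/
noncomputable def manyActionsVariance {S A : Type*} [Fintype S] [Fintype A]
    (p0 : S → ℝ) (π : S → A → ℝ) (g : S → A → ℝ) (N : ℕ) : ℝ :=
  (∑ s, ∑ a : Fin N → A,
      p0 s * (∏ n, π s (a n)) * ((1 / (N : ℝ)) * ∑ n, g s (a n)) ^ 2)
    - (∑ s, ∑ a : Fin N → A,
        p0 s * (∏ n, π s (a n)) * ((1 / (N : ℝ)) * ∑ n, g s (a n))) ^ 2

/-- Lag-`t` covariance of the `N`-action estimator under the joint law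
`s₀ ∼ p₀`, `a¹,…,aᴺ` i.i.d. `∼ π(·|s₀)`, `s_t ∼ p_t(·|s₀,a¹)`,
`b¹,…,bᴺ` i.i.d. `∼ π(·|s_t)`. -/
noncomputable def manyActionsLagCov {S A : Type*} [Fintype S] [Fintype A]
    (p0 : S → ℝ) (π : S → A → ℝ) (g : S → A → ℝ) (N : ℕ) (hN : 0 < N)
    (pt : S → A → S → ℝ) : ℝ :=
  (∑ s0, ∑ a : Fin N → A, ∑ st, ∑ b : Fin N → A,
      p0 s0 * (∏ n, π s0 (a n)) * pt s0 (a ⟨0, hN⟩) st * (∏ m, π st (b m)) *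
        (((1 / (N : ℝ)) * ∑ n, g s0 (a n)) * ((1 / (N : ℝ)) * ∑ m, g st (b m))))
    - (∑ s0, ∑ a : Fin N → A, ∑ st, ∑ b : Fin N → A,
        p0 s0 * (∏ n, π s0 (a n)) * pt s0 (a ⟨0, hN⟩) st * (∏ m, π st (b m)) *
          ((1 / (N : ℝ)) * ∑ n, g s0 (a n)))
      * (∑ s0, ∑ a : Fin N → A, ∑ st, ∑ b : Fin N → A,
          p0 s0 * (∏ n, π s0 (a n)) * pt s0 (a ⟨0, hN⟩) st * (∏ m, π st (b m)) *
            ((1 / (N : ℝ)) * ∑ m, g st (b m)))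

/-- Expectation of a product of functions of distinct coordinates under a product weight. -/
lemma sum_pi_prod_mul_prod {ι A : Type*} [Fintype ι] [DecidableEq ι] [Fintype A]
    (w : A → ℝ) (F : ι → A → ℝ) :
    ∑ a : ι → A, (∏ n, w (a n)) * ∏ n, F n (a n) = ∏ n, ∑ x, w x * F n x := by
  rw [Finset.prod_univ_sum, Fintype.piFinset_univ]
  simp only [Finset.prod_mul_distrib]

lemma sum_pi_prod {ι A : Type*} [Fintype ι] [DecidableEq ι] [Fintype A]
    (w : A → ℝ) (hw : ∑ x, w x = 1) :
    ∑ a : ι → A, ∏ n, w (a n) = 1 := by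
  simpa [hw] using sum_pi_prod_mul_prod (ι := ι) w (fun _ _ => 1)

/-- The coordinates are distributed according to the weight. -/
lemma sum_pi_prod_mul_apply {ι A : Type*} [Fintype ι] [DecidableEq ι] [Fintype A]
    (w : A → ℝ) (hw : ∑ x, w x = 1) (f : A → ℝ) (i : ι) :
    ∑ a : ι → A, (∏ n, w (a n)) * f (a i) = ∑ x, w x * f x := by
  have h := sum_pi_prod_mul_prod w (fun n x => if n = i then f x else 1)
  have hn : ∀ n, ∑ x, w x * (if n = i then f x else 1)
      = if n = i then ∑ x, w x * f x else 1 := by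
    intro n
    split_ifs <;> simp [hw]
  simp only [hn] at h
  simpa using h

/-- Distinct coordinates are uncorrelated. -/
lemma sum_pi_prod_mul_apply_mul_apply {ι A : Type*} [Fintype ι] [DecidableEq ι] [Fintype A]
    (w : A → ℝ) (hw : ∑ x, w x = 1) (f h : A → ℝ) {i j : ι} (hij : i ≠ j) :
    ∑ a : ι → A, (∏ n, w (a n)) * (f (a i) * h (a j))
      = (∑ x, w x * f x) * ∑ x, w x * h x := by
  have key := sum_pi_prod_mul_prod w
    (fun n x => (if n = i then f x else 1) * (if n = j then h x else 1))
  have hn : ∀ n, ∑ x, w x * ((if n = i then f x else 1) * (if n = j then h x else 1))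
      = (if n = i then ∑ x, w x * f x else 1) * (if n = j then ∑ x, w x * h x else 1) := by
    intro n
    by_cases hi : n = i
    · have hj : n ≠ j := fun e => hij (hi.symm.trans e)
      simp [hi, hij]
    · by_cases hj : n = j <;> simp [hi, hj, hw, hij.symm]
  simp only [hn, Finset.prod_mul_distrib] at key
  simpa only [Finset.prod_ite_eq', Finset.mem_univ, if_true] using key

lemma sum_pi_prod_mul_sum {ι A : Type*} [Fintype ι] [DecidableEq ι] [Fintype A]
    (w : A → ℝ) (hw : ∑ x, w x = 1) (f : A → ℝ) :
    ∑ a : ι → A, (∏ n, w (a n)) * ∑ n, f (a n) = Fintype.card ι * ∑ x, w x * f x := by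
  have h : ∀ a : ι → A, (∏ n, w (a n)) * ∑ n, f (a n) = ∑ i, (∏ n, w (a n)) * f (a i) :=
    fun a => Finset.mul_sum _ _ _
  simp_rw [h]
  rw [Finset.sum_comm]
  simp [sum_pi_prod_mul_apply w hw f]

lemma sum_pi_prod_mul_sum_mul_apply {ι A : Type*} [Fintype ι] [DecidableEq ι] [Fintype A]
    (w : A → ℝ) (hw : ∑ x, w x = 1) (f h : A → ℝ) (i : ι) :
    ∑ a : ι → A, (∏ n, w (a n)) * ((∑ n, f (a n)) * h (a i))
      = (∑ x, w x * (f x * h x))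
        + ((Fintype.card ι : ℝ) - 1) * ((∑ x, w x * f x) * ∑ x, w x * h x) := by
  have hexp : ∀ a : ι → A, (∏ n, w (a n)) * ((∑ n, f (a n)) * h (a i))
      = ∑ k, (∏ n, w (a n)) * (f (a k) * h (a i)) := by
    intro a
    rw [Finset.sum_mul, Finset.mul_sum]
  simp_rw [hexp]
  rw [Finset.sum_comm, ← Finset.add_sum_erase _ _ (Finset.mem_univ i),
    sum_pi_prod_mul_apply w hw (fun x => f x * h x) i,
    Finset.sum_congr rfl fun n hn =>
      sum_pi_prod_mul_apply_mul_apply w hw f h (Finset.ne_of_mem_erase hn)]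
  have hc : 1 ≤ Fintype.card ι := Fintype.card_pos_iff.mpr ⟨i⟩
  simp [Finset.card_erase_of_mem, Nat.cast_sub hc]

lemma sum_pi_prod_mul_sum_sq {ι A : Type*} [Fintype ι] [DecidableEq ι] [Fintype A]
    (w : A → ℝ) (hw : ∑ x, w x = 1) (f : A → ℝ) :
    ∑ a : ι → A, (∏ n, w (a n)) * (∑ n, f (a n)) ^ 2
      = Fintype.card ι * ((∑ x, w x * f x ^ 2)
        + ((Fintype.card ι : ℝ) - 1) * (∑ x, w x * f x) ^ 2) := by
  have h : ∀ a : ι → A, (∏ n, w (a n)) * (∑ n, f (a n)) ^ 2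
      = ∑ i, (∏ n, w (a n)) * ((∑ n, f (a n)) * f (a i)) := by
    intro a
    rw [← Finset.mul_sum, ← Finset.mul_sum, sq]
  simp_rw [h]
  rw [Finset.sum_comm]
  simp [sum_pi_prod_mul_sum_mul_apply w hw f f, sq, mul_add]

/-- Law of total variance for the `N`-action estimator. -/
lemma manyActionsVariance_eq {S A : Type*} [Fintype S] [Fintype A]
    (p0 : S → ℝ) (π : S → A → ℝ) (hπsum : ∀ s, ∑ a, π s a = 1)
    (g : S → A → ℝ) (N : ℕ) (hN : 0 < N) :
    manyActionsVariance p0 π g N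
      = ((∑ s, p0 s * gbar π g s ^ 2) - (∑ s, p0 s * gbar π g s) ^ 2)
        + (1 / (N : ℝ)) * ∑ s, p0 s * ((∑ a, π s a * g s a ^ 2) - gbar π g s ^ 2) := by
  have hN' : (N : ℝ) ≠ 0 := by positivity
  have h2 : ∀ s, ∑ a : Fin N → A,
      p0 s * (∏ n, π s (a n)) * ((1 / (N : ℝ)) * ∑ n, g s (a n)) ^ 2
      = p0 s * gbar π g s ^ 2
        + 1 / (N : ℝ) * (p0 s * ((∑ a, π s a * g s a ^ 2) - gbar π g s ^ 2)) := by
    intro s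
    have h := sum_pi_prod_mul_sum_sq (ι := Fin N) (π s) (hπsum s) (g s)
    rw [Fintype.card_fin] at h
    calc _ = p0 s * (1 / (N : ℝ)) ^ 2 *
          ∑ a : Fin N → A, (∏ n, π s (a n)) * (∑ n, g s (a n)) ^ 2 := by
          rw [Finset.mul_sum]
          exact Finset.sum_congr rfl fun a _ => by ring
      _ = _ := by
          rw [h, gbar]
          field_simp
          ring
  have h1 : ∀ s, ∑ a : Fin N → A,
      p0 s * (∏ n, π s (a n)) * ((1 / (N : ℝ)) * ∑ n, g s (a n)) = p0 s * gbar π g s := by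
    intro s
    have h := sum_pi_prod_mul_sum (ι := Fin N) (π s) (hπsum s) (g s)
    rw [Fintype.card_fin] at h
    calc _ = p0 s * (1 / (N : ℝ)) *
          ∑ a : Fin N → A, (∏ n, π s (a n)) * ∑ n, g s (a n) := by
          rw [Finset.mul_sum]
          exact Finset.sum_congr rfl fun a _ => by ring
      _ = _ := by
          rw [h, gbar]
          field_simp
  simp only [manyActionsVariance, h1, h2, Finset.sum_add_distrib, ← Finset.mul_sum]
  ring

/-- Lag covariance of the `N`-action estimator, split according to whether the action driving
the transition is the one being averaged. -/
lemma manyActionsLagCov_eq {S A : Type*} [Fintype S] [Fintype A]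
    (p0 : S → ℝ) (π : S → A → ℝ) (hπsum : ∀ s, ∑ a, π s a = 1)
    (g : S → A → ℝ) (N : ℕ) (hN : 0 < N)
    (pt : S → A → S → ℝ) (hptsum : ∀ s a, ∑ s', pt s a s' = 1) :
    manyActionsLagCov p0 π g N hN pt
      = ((∑ s0, p0 s0 * gbar π g s0 * mbar π g pt s0)
          - (∑ s, p0 s * gbar π g s) * (∑ s, p0 s * mbar π g pt s))
        + (1 / (N : ℝ)) * ∑ s0, p0 s0 *
            ((∑ a, π s0 a * g s0 a * mker π g pt s0 a) - gbar π g s0 * mbar π g pt s0) := by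
  have hN' : (N : ℝ) ≠ 0 := by positivity
  have hG : ∀ s, ∑ b : Fin N → A, (∏ m, π s (b m)) * ((1 / (N : ℝ)) * ∑ m, g s (b m))
      = gbar π g s := by
    intro s
    have h := sum_pi_prod_mul_sum (ι := Fin N) (π s) (hπsum s) (g s)
    rw [Fintype.card_fin] at h
    calc _ = (1 / (N : ℝ)) * ∑ b : Fin N → A, (∏ m, π s (b m)) * ∑ m, g s (b m) := by
          rw [Finset.mul_sum]
          exact Finset.sum_congr rfl fun a _ => by ring
      _ = _ := by
          rw [h, gbar]
          field_simp
  have hXY : ∀ (c x : ℝ) (s0 : S) (a : A), ∑ st, ∑ b : Fin N → A,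
      c * pt s0 a st * (∏ m, π st (b m)) * (x * ((1 / (N : ℝ)) * ∑ m, g st (b m)))
      = c * (x * mker π g pt s0 a) := by
    intro c x s0 a
    rw [mker, Finset.mul_sum, Finset.mul_sum]
    refine Finset.sum_congr rfl fun st _ => ?_
    rw [← hG st, Finset.mul_sum, Finset.mul_sum, Finset.mul_sum]
    exact Finset.sum_congr rfl fun b _ => by ring
  have hX : ∀ (c x : ℝ) (s0 : S) (a : A), ∑ st, ∑ b : Fin N → A,
      c * pt s0 a st * (∏ m, π st (b m)) * x = c * x := by
    intro c x s0 a
    have hb : ∀ st, ∑ b : Fin N → A, c * pt s0 a st * (∏ m, π st (b m)) * x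
        = c * x * pt s0 a st := by
      intro st
      rw [← Finset.sum_mul, ← Finset.mul_sum, sum_pi_prod (π st) (hπsum st)]
      ring
    rw [Finset.sum_congr rfl fun st _ => hb st, ← Finset.mul_sum, hptsum, mul_one]
  have hY : ∀ (c : ℝ) (s0 : S) (a : A), ∑ st, ∑ b : Fin N → A,
      c * pt s0 a st * (∏ m, π st (b m)) * ((1 / (N : ℝ)) * ∑ m, g st (b m))
      = c * mker π g pt s0 a := by
    intro c s0 a
    simpa using hXY c 1 s0 a
  have eXY : ∀ s0, ∑ a : Fin N → A, p0 s0 * (∏ n, π s0 (a n)) *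
        (((1 / (N : ℝ)) * ∑ n, g s0 (a n)) * mker π g pt s0 (a ⟨0, hN⟩))
      = p0 s0 * gbar π g s0 * mbar π g pt s0 + (1 / (N : ℝ)) * (p0 s0 *
          ((∑ a, π s0 a * g s0 a * mker π g pt s0 a) - gbar π g s0 * mbar π g pt s0)) := by
    intro s0
    have h := sum_pi_prod_mul_sum_mul_apply (π s0) (hπsum s0) (g s0)
      (mker π g pt s0) (⟨0, hN⟩ : Fin N)
    rw [Fintype.card_fin] at h
    calc _ = p0 s0 * (1 / (N : ℝ)) * ∑ a : Fin N → A, (∏ n, π s0 (a n)) *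
          ((∑ n, g s0 (a n)) * mker π g pt s0 (a ⟨0, hN⟩)) := by
          rw [Finset.mul_sum]
          exact Finset.sum_congr rfl fun a _ => by ring
      _ = _ := by
          rw [h, gbar, mbar]
          simp only [mul_assoc]
          field_simp
          ring
  have eX : ∀ s0, ∑ a : Fin N → A, p0 s0 * (∏ n, π s0 (a n)) *
      ((1 / (N : ℝ)) * ∑ n, g s0 (a n)) = p0 s0 * gbar π g s0 := by
    intro s0
    rw [← hG s0, Finset.mul_sum]
    exact Finset.sum_congr rfl fun a _ => by ring
  have eY : ∀ s0, ∑ a : Fin N → A, p0 s0 * (∏ n, π s0 (a n)) * mker π g pt s0 (a ⟨0, hN⟩)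
      = p0 s0 * mbar π g pt s0 := by
    intro s0
    simp only [mul_assoc]
    rw [← Finset.mul_sum,
      sum_pi_prod_mul_apply (π s0) (hπsum s0) (mker π g pt s0) (⟨0, hN⟩ : Fin N), mbar]
  simp only [manyActionsLagCov, hXY, hX, hY, eXY, eX, eY, Finset.sum_add_distrib,
    ← Finset.mul_sum]
  ring

/-- Decomposition of the Markov-chain CLT expression for the variance
of the many-actions SPG estimator (Lemma 3.1 combined with the CLT formula):
`T·V` splits into a marginalized-policy component, reduced only by `T`, plus `1/N` times
a policy-dependent component, reduced by both `N` and `T`. -/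
theorem spg_variance_decomposition
    {S A : Type*} [Fintype S] [Fintype A] [Nonempty S] [Nonempty A]
    (p0 : S → ℝ) (hp0 : ∀ s, 0 ≤ p0 s) (hp0sum : ∑ s, p0 s = 1)
    (π : S → A → ℝ) (hπ : ∀ s a, 0 ≤ π s a) (hπsum : ∀ s, ∑ a, π s a = 1)
    (g : S → A → ℝ) (T N : ℕ) (hT : 1 ≤ T) (hN : 0 < N)
    (pt : ℕ → S → A → S → ℝ)
    (hpt : ∀ t, 1 ≤ t → t < T → ∀ s a s', 0 ≤ pt t s a s')
    (hptsum : ∀ t, 1 ≤ t → t < T → ∀ s a, ∑ s', pt t s a s' = 1) :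
    (T : ℝ) *
        ((1 / (T : ℝ)) * manyActionsVariance p0 π g N
          + 2 * ∑ t ∈ Finset.Ico 1 T,
              (((T : ℝ) - t) / (T : ℝ) ^ 2) * manyActionsLagCov p0 π g N hN (pt t))
    = -- marginalized-policy component, reduced only by T
      (((∑ s, p0 s * gbar π g s ^ 2) - (∑ s, p0 s * gbar π g s) ^ 2)
        + 2 * ∑ t ∈ Finset.Ico 1 T, (((T : ℝ) - t) / T) *
            ((∑ s0, p0 s0 * gbar π g s0 * mbar π g (pt t) s0)
              - (∑ s, p0 s * gbar π g s) * (∑ s, p0 s * mbar π g (pt t) s)))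
      -- policy-dependent component, reduced by both N and T
      + (1 / (N : ℝ)) *
          ((∑ s, p0 s * ((∑ a, π s a * g s a ^ 2) - gbar π g s ^ 2))
            + 2 * ∑ t ∈ Finset.Ico 1 T, (((T : ℝ) - t) / T) *
                (∑ s0, p0 s0 *
                  ((∑ a, π s0 a * g s0 a * mker π g (pt t) s0 a)
                    - gbar π g s0 * mbar π g (pt t) s0))) := by
  have hT' : (T : ℝ) ≠ 0 := by positivity
  have hcov := fun t (ht : t ∈ Finset.Ico 1 T) =>
    congrArg ((((T : ℝ) - t) / (T : ℝ) ^ 2) * ·)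
      (manyActionsLagCov_eq p0 π hπsum g N hN (pt t)
        (hptsum t (Finset.mem_Ico.mp ht).1 (Finset.mem_Ico.mp ht).2))
  rw [manyActionsVariance_eq p0 π hπsum g N hN, Finset.sum_congr rfl hcov]
  have hscale : ∀ F : ℕ → ℝ, ∑ t ∈ Finset.Ico 1 T, (((T : ℝ) - t) / T) * F t
      = T * ∑ t ∈ Finset.Ico 1 T, (((T : ℝ) - t) / (T : ℝ) ^ 2) * F t := by
    intro F
    rw [Finset.mul_sum]
    refine Finset.sum_congr rfl fun t _ => ?_
    field_simp
  have hsplit : ∀ F G : ℕ → ℝ,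
      ∑ t ∈ Finset.Ico 1 T, (((T : ℝ) - t) / (T : ℝ) ^ 2) * (F t + (1 / (N : ℝ)) * G t)
      = (∑ t ∈ Finset.Ico 1 T, (((T : ℝ) - t) / (T : ℝ) ^ 2) * F t)
        + (1 / (N : ℝ)) * ∑ t ∈ Finset.Ico 1 T, (((T : ℝ) - t) / (T : ℝ) ^ 2) * G t := by
    intro F G
    rw [Finset.mul_sum, ← Finset.sum_add_distrib]
    exact Finset.sum_congr rfl fun t _ => by ring
  rw [hsplit, hscale, hscale]
  field_simp
  ring
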